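/- Let k ≥ 1 be an integer, let α_i = -1 + 2i/k for i = 0,…,k, let μ ∈ ℝ and σ > 0, and let p̃_i = Φ_{μ,σ}(α_i) − Φ_{μ,σ}(α_{i−1}). If 2 ≤ i ≤ k and α_{i−1} < μ < α_i, then p̃_i > p̃_{i−1}. -/

import Mathlib

open MeasureTheory ProbabilityTheory

/-- `Phi μ σ t` is the CDF of the normal distribution `N(μ, σ²)` evaluated at `t`. -/
noncomputable def Phi (μ σ : ℝ) (t : ℝ) : ℝ :=
  ((gaussianReal μ (σ ^ 2).toNNReal) (Set.Iic t)).toReal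

lemma gaussianPDFReal_lt_gaussianPDFReal_of_sq_lt {μ x y : ℝ} {v : NNReal} (hv : v ≠ 0)
    (h : (x - μ) ^ 2 < (y - μ) ^ 2) : gaussianPDFReal μ v y < gaussianPDFReal μ v x := by
  have hv' : (0 : ℝ) < v := NNReal.coe_pos.2 (pos_iff_ne_zero.2 hv)
  unfold gaussianPDFReal
  gcongr

lemma continuous_gaussianPDFReal (μ : ℝ) (v : NNReal) : Continuous (gaussianPDFReal μ v) := by
  unfold gaussianPDFReal
  fun_prop

lemma Phi_sub_Phi {σ : ℝ} (μ : ℝ) (hσ : 0 < σ) (a b : ℝ) :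
    Phi μ σ b - Phi μ σ a = ∫ x in a..b, gaussianPDFReal μ (σ ^ 2).toNNReal x := by
  have hv : (σ ^ 2).toNNReal ≠ 0 := (Real.toNNReal_pos.2 (by positivity)).ne'
  have hPhi (t : ℝ) : Phi μ σ t = ∫ x in Set.Iic t, gaussianPDFReal μ (σ ^ 2).toNNReal x := by
    rw [Phi, gaussianReal_apply_eq_integral μ hv, ENNReal.toReal_ofReal]
    exact integral_nonneg fun x => gaussianPDFReal_nonneg _ _ x
  have hint := integrable_gaussianPDFReal μ (σ ^ 2).toNNReal
  rw [hPhi, hPhi, intervalIntegral.integral_Iic_sub_Iic hint.integrableOn hint.integrableOn]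

/-- Left of the mean, the normal distribution gives the interval of length `h` to the right of `a`
more mass than the one to the left of `a`. -/
lemma Phi_sub_Phi_lt_Phi_sub_Phi {μ σ a h : ℝ} (hσ : 0 < σ) (ha : a < μ) (hh : 0 < h) :
    Phi μ σ a - Phi μ σ (a - h) < Phi μ σ (a + h) - Phi μ σ a := by
  have hv : (σ ^ 2).toNNReal ≠ 0 := (Real.toNNReal_pos.2 (by positivity)).ne'
  have hcont := continuous_gaussianPDFReal μ (σ ^ 2).toNNReal
  have hlt {x : ℝ} (hx : a < x) : gaussianPDFReal μ (σ ^ 2).toNNReal (2 * a - x) <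
      gaussianPDFReal μ (σ ^ 2).toNNReal x :=
    gaussianPDFReal_lt_gaussianPDFReal_of_sq_lt hv
      (by nlinarith [mul_pos (sub_pos.2 ha) (sub_pos.2 hx)])
  have hreflect : ∫ x in (a - h)..a, gaussianPDFReal μ (σ ^ 2).toNNReal x =
      ∫ x in a..(a + h), gaussianPDFReal μ (σ ^ 2).toNNReal (2 * a - x) := by
    rw [intervalIntegral.integral_comp_sub_left (gaussianPDFReal μ (σ ^ 2).toNNReal)]
    congr 1 <;> ring
  rw [Phi_sub_Phi μ hσ, Phi_sub_Phi μ hσ, hreflect]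
  exact intervalIntegral.integral_lt_integral_of_continuousOn_of_le_of_exists_lt (by linarith)
    (hcont.comp (continuous_const.sub continuous_id)).continuousOn hcont.continuousOn
    (fun x hx => (hlt hx.1).le) ⟨a + h, ⟨by linarith, le_rfl⟩, hlt (by linarith)⟩

theorem stmt_5 (k : ℕ) (hk : 1 ≤ k) (μ σ : ℝ) (hσ : 0 < σ)
    (α : ℕ → ℝ) (hα : ∀ i, α i = -1 + 2 * (i : ℝ) / (k : ℝ))
    (ptilde : ℕ → ℝ)
    (hpt : ∀ i, ptilde i = Phi μ σ (α i) - Phi μ σ (α (i - 1)))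
    (i : ℕ) (hi1 : 2 ≤ i) (hik : i ≤ k)
    (hμ1 : α (i - 1) < μ) (hμ2 : μ < α i) :
    ptilde i > ptilde (i - 1) := by
  obtain ⟨j, rfl⟩ := Nat.exists_eq_add_of_le' hi1
  have hk' : (0 : ℝ) < k := by exact_mod_cast hk
  have hright : α (j + 2) = α (j + 1) + 2 / k := by
    simp only [hα]; push_cast; ring
  have hleft : α j = α (j + 1) - 2 / k := by
    simp only [hα]; push_cast; ring
  rw [show j + 2 - 1 = j + 1 from rfl] at hμ1 ⊢
  rw [hpt, hpt, show j + 2 - 1 = j + 1 from rfl, Nat.add_sub_cancel, hright, hleft]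
  exact Phi_sub_Phi_lt_Phi_sub_Phi hσ hμ1 (by positivity)
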